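/- Lax form of the equations of motion in the trigonometric case: let x_i : ℝ → ℂ be twice differentiable with sinh(x_i(t) − x_j(t)) ≠ 0 for all t and i ≠ j, let a_i, b_i : ℝ → ℂˡ be differentiable, λ_i : ℝ → ℂ, and set f_{ij}(t) = b_i(t)·a_j(t). Assume for all t: (i) b_i·a_i = 2; (ii) ẍ_i = −2·Σ_{j≠i} f_{ij}f_{ji}·cosh(x_i−x_j)/sinh³(x_i−x_j); (iii) ȧ_i = −Σ_{j≠i} a_j·f_{ji}/sinh²(x_i−x_j) − λ_i a_i; (iv) ḃ_i = Σ_{j≠i} b_j·f_{ij}/sinh²(x_i−x_j) + λ_i b_i. Then for every z ∈ ℂ with sinh z ≠ 0, the matrices L(t) with entries L_{ii} = ẋ_i − 2coth z, L_{ij} = f_{ij}(coth(x_i−x_j) − coth z) (i ≠ j), and M(t) with entries M_{ii} = −λ_i, M_{ij} = −f_{ij}/sinh²(x_i−x_j) (i ≠ j), satisfy dL/dt = L·M − M·L. -/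

import Mathlib

open Finset

/-- The addition formula for `coth`, in the form used to verify the Lax equation. -/
theorem coth_add_sub_mul_eq {p q : ℂ} (C : ℂ) (hp : Complex.sinh p ≠ 0)
    (hq : Complex.sinh q ≠ 0) (hpq : Complex.sinh (p + q) ≠ 0) :
    (1 / Complex.sinh p ^ 2 - 1 / Complex.sinh q ^ 2)
        * (Complex.cosh (p + q) / Complex.sinh (p + q) - C)
      = 1 / Complex.sinh p ^ 2 * (Complex.cosh q / Complex.sinh q - C)
        - (Complex.cosh p / Complex.sinh p - C) * (1 / Complex.sinh q ^ 2) := by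
  have hP := Complex.cosh_sq p
  have hQ := Complex.cosh_sq q
  have key : (1 / Complex.sinh p ^ 2 - 1 / Complex.sinh q ^ 2)
        * (Complex.cosh (p + q) / Complex.sinh (p + q))
      = 1 / Complex.sinh p ^ 2 * (Complex.cosh q / Complex.sinh q)
        - Complex.cosh p / Complex.sinh p * (1 / Complex.sinh q ^ 2) := by
    field_simp
    rw [Complex.cosh_add, Complex.sinh_add]
    linear_combination (Complex.sinh p * Complex.sinh q) * (hP - hQ)
  linear_combination key

theorem hasDerivAt_coth_sub {u v : ℝ → ℂ} {u' v' : ℂ} {t : ℝ} (hu : HasDerivAt u u' t)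
    (hv : HasDerivAt v v' t) (h : Complex.sinh (u t - v t) ≠ 0) :
    HasDerivAt (fun s => Complex.cosh (u s - v s) / Complex.sinh (u s - v s))
      (-(u' - v') / Complex.sinh (u t - v t) ^ 2) t := by
  have hd := hu.sub hv
  have hc := (Complex.hasDerivAt_cosh (u t - v t)).comp t hd
  have hs := (Complex.hasDerivAt_sinh (u t - v t)).comp t hd
  refine (hc.div hs h).congr_deriv ?_
  simp only [Function.comp_apply, Pi.sub_apply]
  congr 1
  linear_combination -(u' - v') * Complex.cosh_sq (u t - v t)

theorem hasDerivAt_sum_mul {ι : Type*} [Fintype ι] {u v : ℝ → ι → ℂ} {u' v' : ι → ℂ} {t : ℝ}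
    (hu : HasDerivAt u u' t) (hv : HasDerivAt v v' t) :
    HasDerivAt (fun s => ∑ α, u s α * v s α) (∑ α, (u' α * v t α + u t α * v' α)) t :=
  HasDerivAt.fun_sum fun α _ => (hasDerivAt_pi.1 hu α).mul (hasDerivAt_pi.1 hv α)

/-- Lax form `dL/dt = [L,M]` of the equations of motion of the trigonometric
spin Calogero–Moser system. -/
theorem trigonometric_lax_form (N l : ℕ)
    (x x' : Fin N → ℝ → ℂ) (a b : Fin N → ℝ → Fin l → ℂ) (lam : Fin N → ℝ → ℂ)
    (hxne : ∀ (t : ℝ) (i j : Fin N), i ≠ j → Complex.sinh (x i t - x j t) ≠ 0)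
    (hx : ∀ (i : Fin N) (t : ℝ), HasDerivAt (x i) (x' i t) t)
    (hba : ∀ (i : Fin N) (t : ℝ), (∑ α : Fin l, b i t α * a i t α) = 2)
    (hacc : ∀ (i : Fin N) (t : ℝ), HasDerivAt (x' i)
      (-2 * ∑ j ∈ Finset.univ.erase i,
        (∑ α : Fin l, b i t α * a j t α) * (∑ α : Fin l, b j t α * a i t α)
          * Complex.cosh (x i t - x j t) / Complex.sinh (x i t - x j t) ^ 3) t)
    (ha : ∀ (i : Fin N) (t : ℝ), HasDerivAt (a i)
      (-(∑ j ∈ Finset.univ.erase i,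
          ((∑ α : Fin l, b j t α * a i t α) / Complex.sinh (x i t - x j t) ^ 2) • a j t)
        - lam i t • a i t) t)
    (hb : ∀ (i : Fin N) (t : ℝ), HasDerivAt (b i)
      ((∑ j ∈ Finset.univ.erase i,
          ((∑ α : Fin l, b i t α * a j t α) / Complex.sinh (x i t - x j t) ^ 2) • b j t)
        + lam i t • b i t) t) :
    ∀ z : ℂ, Complex.sinh z ≠ 0 →
      let f : Fin N → Fin N → ℝ → ℂ := fun i j t => ∑ α : Fin l, b i t α * a j t α
      let L : ℝ → Matrix (Fin N) (Fin N) ℂ := fun t => Matrix.of fun i j =>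
        if i = j then x' i t - 2 * (Complex.cosh z / Complex.sinh z)
        else f i j t * (Complex.cosh (x i t - x j t) / Complex.sinh (x i t - x j t)
          - Complex.cosh z / Complex.sinh z)
      let M : ℝ → Matrix (Fin N) (Fin N) ℂ := fun t => Matrix.of fun i j =>
        if i = j then -lam i t else -f i j t / Complex.sinh (x i t - x j t) ^ 2
      ∀ (t : ℝ) (i j : Fin N),
        HasDerivAt (fun s => L s i j) ((L t * M t - M t * L t) i j) t := by
  intro z _ f L M t i j
  have hf : ∀ i j, HasDerivAt (f i j)
      ((∑ k ∈ univ.erase i, f i k t * f k j t / Complex.sinh (x i t - x k t) ^ 2)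
        - (∑ k ∈ univ.erase j, f i k t * f k j t / Complex.sinh (x j t - x k t) ^ 2)
        + (lam i t - lam j t) * f i j t) t := by
    intro i j
    refine (hasDerivAt_sum_mul (hb i t) (ha j t)).congr_deriv ?_
    have h1 : ∑ α, (∑ k ∈ univ.erase i,
        (f i k t / Complex.sinh (x i t - x k t) ^ 2) • b k t) α * a j t α
        = ∑ k ∈ univ.erase i, f i k t * f k j t / Complex.sinh (x i t - x k t) ^ 2 := by
      simp only [Finset.sum_apply, Pi.smul_apply, smul_eq_mul, Finset.sum_mul]
      rw [Finset.sum_comm]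
      refine Finset.sum_congr rfl fun k _ => ?_
      rw [mul_div_right_comm, Finset.mul_sum]
      exact Finset.sum_congr rfl fun α _ => by ring
    have h2 : ∑ α, b i t α * (∑ k ∈ univ.erase j,
        (f k j t / Complex.sinh (x j t - x k t) ^ 2) • a k t) α
        = ∑ k ∈ univ.erase j, f i k t * f k j t / Complex.sinh (x j t - x k t) ^ 2 := by
      simp only [Finset.sum_apply, Pi.smul_apply, smul_eq_mul, Finset.mul_sum]
      rw [Finset.sum_comm]
      refine Finset.sum_congr rfl fun k _ => ?_
      rw [mul_div_assoc, Finset.sum_mul]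
      exact Finset.sum_congr rfl fun α _ => by ring
    have h3 : (lam i t - lam j t) * f i j t
        = ∑ α, (lam i t - lam j t) * (b i t α * a j t α) := Finset.mul_sum _ _ _
    rw [← h1, ← h2, h3, ← Finset.sum_sub_distrib, ← Finset.sum_add_distrib]
    refine Finset.sum_congr rfl fun α _ => ?_
    simp only [Pi.add_apply, Pi.sub_apply, Pi.neg_apply, Pi.smul_apply, smul_eq_mul]
    ring
  have hff : ∀ i, f i i t = 2 := fun i => hba i t
  have hsymm : ∀ i k, Complex.sinh (x k t - x i t) = -Complex.sinh (x i t - x k t) := by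
    intro i k
    rw [← Complex.sinh_neg, neg_sub]
  rw [Matrix.sub_apply, Matrix.mul_apply, Matrix.mul_apply, ← Finset.sum_sub_distrib]
  by_cases hij : i = j
  · subst hij
    have hL : (fun s => L s i i) = fun s => x' i s - 2 * (Complex.cosh z / Complex.sinh z) := by
      funext s
      simp [L]
    rw [hL]
    refine ((hacc i t).sub_const _).congr_deriv ?_
    rw [← Finset.add_sum_erase _ _ (mem_univ i), mul_comm (L t i i), sub_self, zero_add,
      Finset.mul_sum]
    refine Finset.sum_congr rfl fun k hk => ?_
    have hki : k ≠ i := ne_of_mem_erase hk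
    have hs := hxne t i k hki.symm
    have hcosh : Complex.cosh (x k t - x i t) = Complex.cosh (x i t - x k t) := by
      rw [← Complex.cosh_neg, neg_sub]
    simp only [L, M, Matrix.of_apply, if_neg hki, if_neg hki.symm, hsymm i k, hcosh]
    change -2 * (f i k t * f k i t * _ / _) = _
    field_simp
    ring
  · have hL : (fun s => L s i j) = fun s => f i j s *
        (Complex.cosh (x i s - x j s) / Complex.sinh (x i s - x j s)
          - Complex.cosh z / Complex.sinh z) := by
      funext s
      simp [L, hij]
    rw [hL]
    refine ((hf i j).mul ((hasDerivAt_coth_sub (hx i t) (hx j t)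
      (hxne t i j hij)).sub_const _)).congr_deriv ?_
    have hji : j ∈ univ.erase i := mem_erase.2 ⟨Ne.symm hij, mem_univ j⟩
    have hij' : i ∈ univ.erase j := mem_erase.2 ⟨hij, mem_univ i⟩
    rw [← Finset.add_sum_erase _ _ (mem_univ i), ← Finset.add_sum_erase _ _ hji,
      ← Finset.add_sum_erase (univ.erase i) _ hji, ← Finset.add_sum_erase (univ.erase j) _ hij',
      Finset.erase_right_comm (a := j) (b := i)]
    have hrest : ∑ k ∈ (univ.erase i).erase j, (L t i k * M t k j - M t i k * L t k j)
        = ((∑ k ∈ (univ.erase i).erase j,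
            f i k t * f k j t / Complex.sinh (x i t - x k t) ^ 2)
          - ∑ k ∈ (univ.erase i).erase j,
            f i k t * f k j t / Complex.sinh (x j t - x k t) ^ 2)
          * (Complex.cosh (x i t - x j t) / Complex.sinh (x i t - x j t)
            - Complex.cosh z / Complex.sinh z) := by
      rw [← Finset.sum_sub_distrib, Finset.sum_mul]
      refine Finset.sum_congr rfl fun k hk => ?_
      have hkj : k ≠ j := ne_of_mem_erase hk
      have hki : k ≠ i := ne_of_mem_erase (mem_of_mem_erase hk)
      have hadd : x i t - x k t + (x k t - x j t) = x i t - x j t := by ring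
      have key := coth_add_sub_mul_eq (Complex.cosh z / Complex.sinh z)
        (hxne t i k hki.symm) (hxne t k j hkj) (by rw [hadd]; exact hxne t i j hij)
      rw [hadd] at key
      simp only [L, M, Matrix.of_apply, if_neg hki.symm, if_neg hkj, hsymm k j, neg_sq]
      linear_combination -(f i k t * f k j t) * key
    rw [hrest]
    simp only [L, M, Matrix.of_apply, if_neg hij, if_true, hff, hsymm i j, neg_sq]
    ring
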